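/- Let χ : S¹ → S¹ be a bijection such that for all pairs {a,b} and {c,d} of distinct points of S¹ with {a,b} ∩ {c,d} = ∅, the pairs {a,b} and {c,d} are linked if and only if {χ(a),χ(b)} and {χ(c),χ(d)} are linked. Then χ is a homeomorphism of S¹. -/

import Mathlib

noncomputable section

/-- The unit circle in the complex plane. -/
def S1 : Set ℂ := {z : ℂ | ‖z‖ = 1}

/-- Two disjoint pairs `{a,b}`, `{c,d}` of distinct points of the circle are *linked*
(non-nested) if `c` and `d` lie in different connected components of `S¹ \ {a,b}`. -/
def Linked (a b c d : S1) : Prop :=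
  connectedComponentIn ({a, b}ᶜ : Set S1) c ≠ connectedComponentIn ({a, b}ᶜ : Set S1) d

/-- The circle is locally connected. -/
theorem S1_locallyConnected : LocallyConnectedSpace S1 := by
  have h : LocallyConnectedSpace Circle :=
    ChartedSpace.locallyConnectedSpace (EuclideanSpace ℝ (Fin 1)) Circle
  let f : S1 → Circle := fun z => ⟨z.1, by
    have := z.2
    simpa [S1, Submonoid.unitSphere] using this⟩
  let g : Circle → S1 := fun z => ⟨z.1, Circle.norm_coe z⟩
  have hf : Continuous f := by
    apply Continuous.subtype_mk continuous_subtype_val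
  have hg : Continuous g := by
    apply Continuous.subtype_mk continuous_subtype_val
  let e : S1 ≃ₜ Circle :=
    { toFun := f
      invFun := g
      left_inv := fun z => rfl
      right_inv := fun z => rfl
      continuous_toFun := hf
      continuous_invFun := hg }
  exact e.isOpenEmbedding.locallyConnectedSpace

/-- The circle is compact. -/
theorem S1_compact : CompactSpace S1 := by
  have : S1 = Metric.sphere (0 : ℂ) 1 := by
    ext z; simp [S1]
  rw [← isCompact_iff_compactSpace, this]
  exact isCompact_sphere 0 1

/-- Each point has arbitrarily small neighbourhoods that are components of the complement
of two points. -/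
theorem S1_small_arc (p : S1) (U : Set S1) (hU : U ∈ nhds p) :
    ∃ a b : S1, a ≠ b ∧ a ≠ p ∧ b ≠ p ∧ connectedComponentIn ({a, b}ᶜ : Set S1) p ⊆ U := by
  obtain ⟨ε, hε, hball⟩ := Metric.mem_nhds_iff.1 hU
  obtain ⟨t, ht0, ht1, htε⟩ : ∃ t : ℝ, 0 ≤ t ∧ t < 1 ∧ 2 - 2 * t ≤ ε ^ 2 := by
    refine ⟨max 0 (1 - ε ^ 2 / 2), le_max_left _ _, ?_, ?_⟩
    · apply max_lt one_pos
      have := pow_pos hε 2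
      linarith
    · have := le_max_right 0 (1 - ε ^ 2 / 2)
      linarith
  have sq (z : S1) : z.1.re ^ 2 + z.1.im ^ 2 = 1 := by
    have h1 : ‖z.1‖ = 1 := z.2
    have h2 := Complex.sq_norm z.1
    rw [h1, Complex.normSq_apply] at h2
    linarith
  have mk (x y : ℝ) (h : x ^ 2 + y ^ 2 = 1) : (⟨x, y⟩ : ℂ) ∈ S1 := by
    have h2 := Complex.sq_norm (⟨x, y⟩ : ℂ)
    rw [Complex.normSq_apply] at h2
    have h3 : ‖(⟨x, y⟩ : ℂ)‖ ^ 2 = 1 := by rw [h2]; simp only; linarith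
    have h4 := norm_nonneg (⟨x, y⟩ : ℂ)
    show ‖(⟨x, y⟩ : ℂ)‖ = 1
    nlinarith
  have hp := sq p
  set u := p.1.re with hu
  set v := p.1.im with hv
  obtain ⟨s, hs0, hs⟩ : ∃ s : ℝ, 0 < s ∧ s ^ 2 = 1 - t ^ 2 := by
    have : 0 < 1 - t ^ 2 := by nlinarith
    exact ⟨Real.sqrt (1 - t ^ 2), Real.sqrt_pos.2 this, Real.sq_sqrt this.le⟩
  let a : S1 := ⟨⟨u * t - v * s, v * t + u * s⟩, mk _ _ (by
    linear_combination (t ^ 2 + s ^ 2) * hp + hs)⟩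
  let b : S1 := ⟨⟨u * t + v * s, v * t - u * s⟩, mk _ _ (by
    linear_combination (t ^ 2 + s ^ 2) * hp + hs)⟩
  let f : S1 → ℝ := fun z => z.1.re * u + z.1.im * v
  let g : S1 → ℝ := fun z => z.1.im * u - z.1.re * v
  have hf : Continuous f := by
    have := Complex.continuous_re.comp (continuous_subtype_val (p := (· ∈ S1)))
    have := Complex.continuous_im.comp (continuous_subtype_val (p := (· ∈ S1)))
    simp only [Function.comp_def] at *
    fun_prop
  have hfp : f p = 1 := by simp only [f]; linear_combination hp
  have hfa : f a = t := by simp only [f, a]; linear_combination t * hp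
  have hfb : f b = t := by simp only [f, b]; linear_combination t * hp
  have hga : g a = s := by simp only [g, a]; linear_combination s * hp
  have hgb : g b = - s := by simp only [g, b]; linear_combination (-s) * hp
  have hap : a ≠ p := fun h => by rw [h, hfp] at hfa; linarith
  have hbp : b ≠ p := fun h => by rw [h, hfp] at hfb; linarith
  have hab : a ≠ b := fun h => by rw [h, hgb] at hga; linarith
  have key (z : S1) (hz : f z = t) : z = a ∨ z = b := by
    have hz2 := sq z
    have h1 : f z ^ 2 + g z ^ 2 = 1 := by
      simp only [f, g]
      linear_combination (u ^ 2 + v ^ 2) * hz2 + hp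
    have h2 : (g z - s) * (g z + s) = 0 := by
      rw [hz] at h1; linear_combination h1 - hs
    have hre : z.1.re = f z * u - g z * v := by
      simp only [f, g]; linear_combination (-z.1.re) * hp
    have him : z.1.im = f z * v + g z * u := by
      simp only [f, g]; linear_combination (-z.1.im) * hp
    rcases mul_eq_zero.1 h2 with h | h
    · left
      have h : g z = s := by linarith
      apply Subtype.ext
      apply Complex.ext
      · rw [hre, hz, h]; simp only [a]; ring
      · rw [him, hz, h]; simp only [a]; ring
    · right
      have h : g z = -s := by linarith
      apply Subtype.ext
      apply Complex.ext
      · rw [hre, hz, h]; simp only [b]; ring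
      · rw [him, hz, h]; simp only [b]; ring
  refine ⟨a, b, hab, hap, hbp, fun z hz => hball ?_⟩
  have hpm : p ∈ connectedComponentIn ({a, b}ᶜ : Set S1) p :=
    mem_connectedComponentIn (by simp [hap.symm, hbp.symm])
  have hfz : t < f z := by
    by_contra hcon
    push Not at hcon
    obtain ⟨w, hw, hwt⟩ := isPreconnected_connectedComponentIn.intermediate_value hz hpm
      hf.continuousOn (show t ∈ Set.Icc (f z) (f p) from ⟨hcon, by rw [hfp]; exact ht1.le⟩)
    have := connectedComponentIn_subset _ _ hw
    rcases key w hwt with h | h <;> simp [h] at this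
  have hz2 := sq z
  rw [Metric.mem_ball, Subtype.dist_eq, dist_eq_norm]
  have h2 := Complex.sq_norm (z.1 - p.1)
  rw [Complex.normSq_apply, Complex.sub_re, Complex.sub_im, ← hu, ← hv] at h2
  have h3 : ‖z.1 - p.1‖ ^ 2 = 2 - 2 * f z := by
    rw [h2]; simp only [f]; linear_combination hz2 + hp
  apply lt_of_pow_lt_pow_left₀ 2 hε.le
  linarith

/-- A bijection of the circle preserving linkedness of disjoint pairs of
distinct points is a homeomorphism. -/
theorem homeomorph_of_preserves_linked (χ : S1 → S1) (hbij : Function.Bijective χ)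
    (hlink : ∀ a b c d : S1, a ≠ b → c ≠ d → a ≠ c → a ≠ d → b ≠ c → b ≠ d →
      (Linked a b c d ↔ Linked (χ a) (χ b) (χ c) (χ d))) :
    ∃ e : S1 ≃ₜ S1, ⇑e = χ := by
  have := S1_locallyConnected
  have := S1_compact
  have hc : Continuous χ := by
    rw [continuous_iff_continuousAt]
    intro p
    intro U hU
    obtain ⟨a', b', hab', hap', hbp', hsub⟩ := S1_small_arc (χ p) U hU
    obtain ⟨a, rfl⟩ := hbij.2 a'
    obtain ⟨b, rfl⟩ := hbij.2 b'
    have hab : a ≠ b := fun h => hab' (by rw [h])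
    have hap : a ≠ p := fun h => hap' (by rw [h])
    have hbp : b ≠ p := fun h => hbp' (by rw [h])
    have hopen : IsOpen (connectedComponentIn ({a, b}ᶜ : Set S1) p) :=
      IsOpen.connectedComponentIn (Set.toFinite _).isClosed.isOpen_compl
    have hpm : p ∈ connectedComponentIn ({a, b}ᶜ : Set S1) p :=
      mem_connectedComponentIn (by simp [hap.symm, hbp.symm])
    refine Filter.mem_map.2 (Filter.mem_of_superset (hopen.mem_nhds hpm) ?_)
    intro d hd
    have hdm := connectedComponentIn_subset _ _ hd
    simp only [Set.mem_compl_iff, Set.mem_insert_iff, Set.mem_singleton_iff, not_or] at hdm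
    obtain ⟨hda, hdb⟩ := hdm
    by_cases hdp : p = d
    · subst hdp; exact (mem_of_mem_nhds hU : χ p ∈ U)
    have hnl : ¬ Linked a b p d := fun h => h (connectedComponentIn_eq hd)
    rw [hlink a b p d hab hdp hap (Ne.symm hda) hbp (Ne.symm hdb)] at hnl
    have heq := not_not.1 hnl
    apply hsub
    rw [heq]
    apply mem_connectedComponentIn
    simp [hbij.1.eq_iff, hda, hdb]
  exact ⟨hc.homeoOfEquivCompactToT2 (f := Equiv.ofBijective χ hbij), rfl⟩
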